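/- For every n ≥ 1, κ > 0, and every π : A^n → R>0: ∏_{[i,j] ∈ A^n} π([i,j]) · ∏_{[i,j] ∈ A^n} (LK^B π)([i,j]) = κ^n, and ∏_{[i,j] ∈ A^n} π([i,j])^{i+j} · ∏_{[i,j] ∈ A^n} (LK^B π)([i,j])^{i+j} = κ^{n(n+1)}. -/

import Mathlib

open scoped Classical

noncomputable section

/-- `P̂`: the poset `P` with a new minimum `0̂` and a new maximum `1̂` adjoined. -/
abbrev Phat (P : Type) := WithBot (WithTop P)

instance {P : Type} [Fintype P] : Fintype (Phat P) :=
  inferInstanceAs (Fintype (Option (Option P)))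

/-- The inclusion of `P` into `P̂`. -/
def emb {P : Type} (p : P) : Phat P := ((p : WithTop P) : WithBot (WithTop P))

/-- The new maximum `1̂` of `P̂`. -/
def topHat (P : Type) : Phat P := ((⊤ : WithTop P) : WithBot (WithTop P))

variable {P : Type} [Fintype P] [PartialOrder P]

/-- `∑_{y ⋖ x} π(y)`. -/
def covSumBelow (π : Phat P → ℝ) (x : Phat P) : ℝ :=
  ∑ y : Phat P, if y ⋖ x then π y else 0

/-- `∑_{x ⋖ y} 1/π(y)`. -/
def covSumAboveInv (π : Phat P → ℝ) (x : Phat P) : ℝ :=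
  ∑ y : Phat P, if x ⋖ y then (π y)⁻¹ else 0

/-- The birational order-filter rank toggle `𝐭_i`, in simultaneous form (it agrees with the
composition of the pairwise commuting birational order filter toggles `t_p` over `p ∈ P_i`,
since a toggle `t_p` only changes the value at `p` and only reads values at `p` and at
elements covering or covered by `p`, which have different ranks). -/
def rankToggleB (rk : P → ℕ) (i : ℕ) (π : Phat P → ℝ) : Phat P → ℝ :=
  fun x =>
    if ∃ p : P, rk p = i ∧ x = emb p then
      covSumBelow π x / (π x * covSumAboveInv π x)
    else π x

/-- Apply a word of rank toggles; the head of the list is applied last, matching the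
convention that in a product `𝐭_{i_1} 𝐭_{i_2} ⋯ 𝐭_{i_k}` the rightmost factor acts first. -/
def applyB (rk : P → ℕ) : List ℕ → (Phat P → ℝ) → Phat P → ℝ
  | [] => fun π => π
  | i :: w => fun π => rankToggleB rk i (applyB rk w π)

/-- The word `𝐭_0 𝐭_1 ⋯ 𝐭_r` for rowmotion. -/
def rowWordB (r : ℕ) : List ℕ := List.range (r + 1)

/-- The word `(𝐭_r)(𝐭_{r-1} 𝐭_r) ⋯ (𝐭_0 𝐭_1 ⋯ 𝐭_r)` for rowvacuation. -/
def rvacWordB (r : ℕ) : List ℕ :=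
  (List.range (r + 1)).foldr (fun k acc => (List.range (r + 1)).drop (r - k) ++ acc) []

/-- The word `(𝐭_0)(𝐭_1 𝐭_0) ⋯ (𝐭_r 𝐭_{r-1} ⋯ 𝐭_0)` for dual rowvacuation. -/
def drvacWordB (r : ℕ) : List ℕ :=
  (List.range (r + 1)).foldr (fun k acc => (List.range (k + 1)).reverse ++ acc) []

/-- Birational order filter rowmotion `Row^B_F = 𝐭_0 𝐭_1 ⋯ 𝐭_r`. -/
def RowB (rk : P → ℕ) (r : ℕ) : (Phat P → ℝ) → Phat P → ℝ := applyB rk (rowWordB r)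

/-- The inverse of birational order filter rowmotion, `(Row^B_F)⁻¹ = 𝐭_r ⋯ 𝐭_1 𝐭_0`
(each toggle is an involution, so the reversed word gives the inverse map). -/
def RowInvB (rk : P → ℕ) (r : ℕ) : (Phat P → ℝ) → Phat P → ℝ := applyB rk (rowWordB r).reverse

/-- Birational order filter rowvacuation `Rvac^B_F`. -/
def RvacB (rk : P → ℕ) (r : ℕ) : (Phat P → ℝ) → Phat P → ℝ := applyB rk (rvacWordB r)

/-- Birational order filter dual rowvacuation `DRvac^B_F`. -/
def DRvacB (rk : P → ℕ) (r : ℕ) : (Phat P → ℝ) → Phat P → ℝ := applyB rk (drvacWordB r)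

end

noncomputable section

variable {P : Type} [Fintype P] [PartialOrder P]

/-- The sum, over all maximal chains `C` of `P` containing `p`, of `∏_{y ∈ C} π(y)`. -/
def chainSum (π : P → ℝ) (p : P) : ℝ :=
  ∑ C ∈ Finset.univ.filter
      (fun C : Finset P => IsMaxChain (· ≤ ·) (C : Set P) ∧ p ∈ C),
    ∏ y ∈ C, π y

/-- The birational antichain rank toggle `𝛕_i`, in simultaneous form (it agrees with the
composition of the pairwise commuting birational antichain toggles `τ_p` over `p ∈ P_i`,
since in a graded poset no maximal chain contains two distinct elements of the same rank). -/
def arankToggleB (κ : ℝ) (rk : P → ℕ) (i : ℕ) (π : P → ℝ) : P → ℝ :=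
  fun x => if rk x = i then κ / chainSum π x else π x

/-- Apply a word of antichain rank toggles; the head of the list is applied last. -/
def aApplyB (κ : ℝ) (rk : P → ℕ) : List ℕ → (P → ℝ) → P → ℝ
  | [] => fun π => π
  | i :: w => fun π => arankToggleB κ rk i (aApplyB κ rk w π)

/-- The word `𝛕_r 𝛕_{r-1} ⋯ 𝛕_0` for antichain rowmotion. -/
def arowWordB (r : ℕ) : List ℕ := (List.range (r + 1)).reverse

/-- The word `(𝛕_r)(𝛕_r 𝛕_{r-1}) ⋯ (𝛕_r 𝛕_{r-1} ⋯ 𝛕_1 𝛕_0)` for antichain rowvacuation. -/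
def arvacWordB (r : ℕ) : List ℕ :=
  (List.range (r + 1)).foldr
    (fun k acc => (List.range (r + 1)).reverse.take (k + 1) ++ acc) []

/-- Birational antichain rowmotion `Row^B_A = 𝛕_r 𝛕_{r-1} ⋯ 𝛕_0`. -/
def RowAB (κ : ℝ) (rk : P → ℕ) (r : ℕ) : (P → ℝ) → P → ℝ := aApplyB κ rk (arowWordB r)

/-- Birational antichain rowvacuation `Rvac^B_A`. -/
def RvacAB (κ : ℝ) (rk : P → ℕ) (r : ℕ) : (P → ℝ) → P → ℝ := aApplyB κ rk (arvacWordB r)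

end

/-- The underlying set of the poset `Aⁿ`: pairs `(i,j)` with `1 ≤ i ≤ j ≤ n`,
representing the intervals `[i,j] ⊆ [n]`. -/
def AnP (n : ℕ) : Type := {p : ℕ × ℕ // 1 ≤ p.1 ∧ p.1 ≤ p.2 ∧ p.2 ≤ n}

/-- `Aⁿ` is ordered by containment of intervals. -/
instance (n : ℕ) : PartialOrder (AnP n) where
  le x y := y.val.1 ≤ x.val.1 ∧ x.val.2 ≤ y.val.2
  le_refl x := ⟨le_refl _, le_refl _⟩
  le_trans x y z h1 h2 := ⟨le_trans h2.1 h1.1, le_trans h1.2 h2.2⟩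
  le_antisymm x y h1 h2 :=
    Subtype.ext (Prod.ext_iff.mpr ⟨le_antisymm h2.1 h1.1, le_antisymm h1.2 h2.2⟩)

instance (n : ℕ) : Fintype (AnP n) :=
  Fintype.subtype
    ((Finset.Icc 1 n ×ˢ Finset.Icc 1 n).filter (fun p => 1 ≤ p.1 ∧ p.1 ≤ p.2 ∧ p.2 ≤ n))
    (by
      intro x
      simp only [Finset.mem_filter, Finset.mem_product, Finset.mem_Icc]
      omega)

/-- The rank function of `Aⁿ`: `rk [i,j] = j - i`; `Aⁿ` is graded of rank `n - 1`. -/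
def rkAn (n : ℕ) : AnP n → ℕ := fun p => p.val.2 - p.val.1

noncomputable section

/-- The birational Lalanne–Kreweras involution `LK^B`: birational antichain rowvacuation of
the graded poset `Aⁿ` (of rank `n - 1`), acting on `A^B_κ(Aⁿ) = (ℝ>0)^(Aⁿ)`. -/
def LKB (n : ℕ) (κ : ℝ) : (AnP n → ℝ) → AnP n → ℝ := RvacAB κ (rkAn n) (n - 1)

end

noncomputable section Chains

open Finset

variable {P : Type} [Fintype P] [PartialOrder P]

/-- The maximal chains of the principal filter `{x | p ≤ x}`. -/
def upChains (p : P) : Finset (Finset P) :=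
  univ.filter fun C : Finset P => IsChain (· ≤ ·) (C : Set P) ∧ (∀ x ∈ C, p ≤ x) ∧
    ∀ y, p ≤ y → (∀ x ∈ C, x ≤ y ∨ y ≤ x) → y ∈ C

/-- The maximal chains of the principal ideal `{x | x ≤ p}`. -/
def downChains (p : P) : Finset (Finset P) :=
  univ.filter fun C : Finset P => IsChain (· ≤ ·) (C : Set P) ∧ (∀ x ∈ C, x ≤ p) ∧
    ∀ y, y ≤ p → (∀ x ∈ C, y ≤ x ∨ x ≤ y) → y ∈ C

/-- The weighted number of maximal chains of `{x | p ≤ x}`. -/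
def upSum (π : P → ℝ) (p : P) : ℝ := ∑ C ∈ upChains p, ∏ y ∈ C, π y

/-- The weighted number of maximal chains of `{x | x ≤ p}`. -/
def downSum (π : P → ℝ) (p : P) : ℝ := ∑ C ∈ downChains p, ∏ y ∈ C, π y

lemma mem_upChains {p : P} {C : Finset P} : C ∈ upChains p ↔
    IsChain (· ≤ ·) (C : Set P) ∧ (∀ x ∈ C, p ≤ x) ∧
      ∀ y, p ≤ y → (∀ x ∈ C, x ≤ y ∨ y ≤ x) → y ∈ C := by
  simp [upChains]

lemma mem_downChains {p : P} {C : Finset P} : C ∈ downChains p ↔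
    IsChain (· ≤ ·) (C : Set P) ∧ (∀ x ∈ C, x ≤ p) ∧
      ∀ y, y ≤ p → (∀ x ∈ C, y ≤ x ∨ x ≤ y) → y ∈ C := by
  simp [downChains]

lemma self_mem_of_mem_upChains {p : P} {C : Finset P} (h : C ∈ upChains p) : p ∈ C := by
  rw [mem_upChains] at h
  exact h.2.2 p le_rfl fun x hx => Or.inr (h.2.1 x hx)

lemma self_mem_of_mem_downChains {p : P} {C : Finset P} (h : C ∈ downChains p) : p ∈ C := by
  rw [mem_downChains] at h
  exact h.2.2 p le_rfl fun x hx => Or.inr (h.2.1 x hx)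

lemma downSum_eq_upSum_dual (π : P → ℝ) (p : P) :
    downSum π p = upSum (P := Pᵒᵈ) (fun x => π (OrderDual.ofDual x)) (OrderDual.toDual p) := by
  unfold downSum upSum
  refine Finset.sum_congr (Finset.ext fun C => ?_) fun _ _ => rfl
  rw [mem_downChains]
  refine Iff.trans ?_ (mem_upChains (P := Pᵒᵈ) (p := OrderDual.toDual p) (C := C)).symm
  exact and_congr ⟨fun h => h.symm, fun h => h.symm⟩ Iff.rfl

lemma upSum_congr {π ρ : P → ℝ} {p : P} (h : ∀ x, p ≤ x → π x = ρ x) :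
    upSum π p = upSum ρ p :=
  Finset.sum_congr rfl fun _ hC =>
    Finset.prod_congr rfl fun x hx => h x ((mem_upChains.1 hC).2.1 x hx)

lemma downSum_congr {π ρ : P → ℝ} {p : P} (h : ∀ x, x ≤ p → π x = ρ x) :
    downSum π p = downSum ρ p :=
  Finset.sum_congr rfl fun _ hC =>
    Finset.prod_congr rfl fun x hx => h x ((mem_downChains.1 hC).2.1 x hx)

lemma upSum_of_isMax (π : P → ℝ) {p : P} (hp : IsMax p) : upSum π p = π p := by
  have : upChains p = {{p}} := by
    ext C
    rw [mem_singleton]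
    constructor
    · intro h
      have hp' := self_mem_of_mem_upChains h
      rw [mem_upChains] at h
      ext x
      rw [mem_singleton]
      exact ⟨fun hx => le_antisymm (hp (h.2.1 x hx)) (h.2.1 x hx), fun hx => hx ▸ hp'⟩
    · rintro rfl
      rw [mem_upChains]
      refine ⟨by simp, by simp, fun y hy _ => ?_⟩
      rw [mem_singleton]
      exact le_antisymm (hp hy) hy
  simp [upSum, this]

lemma upChains_of_not_isMax {p : P} (hp : ¬ IsMax p) :
    upChains p = (univ.filter (p ⋖ ·)).biUnion fun q => (upChains q).image (insert p) := by
  ext C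
  simp only [mem_biUnion, mem_filter, mem_univ, true_and, mem_image]
  constructor
  · intro h
    have hpC := self_mem_of_mem_upChains h
    rw [mem_upChains] at h
    obtain ⟨hc, hl, hm⟩ := h
    have hne : (C.erase p).Nonempty := by
      by_contra hne
      rw [not_nonempty_iff_eq_empty] at hne
      rw [not_isMax_iff] at hp
      obtain ⟨z, hz⟩ := hp
      have hall : ∀ x ∈ C, x = p := by
        intro x hx
        by_contra hxp
        have : x ∈ C.erase p := mem_erase.2 ⟨hxp, hx⟩
        simp [hne] at this
      have := hall z (hm z hz.le fun x hx => Or.inl (hall x hx ▸ hz.le))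
      exact hz.ne' this
    obtain ⟨q, hq⟩ := (C.erase p).exists_minimal hne
    have hqC := mem_erase.1 hq.1
    have hleast : ∀ x ∈ C.erase p, q ≤ x := by
      intro x hx
      rcases hc.total (mem_coe.2 hqC.2) (mem_coe.2 (mem_erase.1 hx).2) with h | h
      · exact h
      · exact hq.2 hx h
    refine ⟨q, ⟨lt_of_le_of_ne (hl q hqC.2) hqC.1.symm, fun z hpz hzq => ?_⟩, C.erase p, ?_,
      insert_erase hpC⟩
    · have hz : z ∈ C := hm z hpz.le fun x hx => by
        by_cases hxp : x = p
        · exact Or.inl (hxp ▸ hpz.le)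
        · exact Or.inr (hzq.le.trans (hleast x (mem_erase.2 ⟨hxp, hx⟩)))
      exact absurd (hleast z (mem_erase.2 ⟨hpz.ne', hz⟩)) (not_le_of_gt hzq)
    · rw [mem_upChains]
      refine ⟨hc.mono (by simp), hleast, fun y hy hy' => ?_⟩
      have hpy : p < y := lt_of_lt_of_le (lt_of_le_of_ne (hl q hqC.2) hqC.1.symm) hy
      refine mem_erase.2 ⟨hpy.ne', hm y hpy.le fun x hx => ?_⟩
      by_cases hxp : x = p
      · exact Or.inl (hxp ▸ hpy.le)
      · exact hy' x (mem_erase.2 ⟨hxp, hx⟩)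
  · rintro ⟨q, hpq, D, hD, rfl⟩
    have hqD := self_mem_of_mem_upChains hD
    rw [mem_upChains] at hD ⊢
    obtain ⟨hc, hl, hm⟩ := hD
    refine ⟨?_, ?_, ?_⟩
    · rw [coe_insert]
      exact hc.insert fun x hx _ => Or.inl (hpq.le.trans (hl x hx))
    · intro x hx
      rcases mem_insert.1 hx with rfl | hx
      · exact le_rfl
      · exact hpq.le.trans (hl x hx)
    · intro y hy hy'
      by_cases hyp : y = p
      · simp [hyp]
      have hpy : p < y := lt_of_le_of_ne hy (Ne.symm hyp)
      refine mem_insert_of_mem (hm y ?_ fun x hx => hy' x (mem_insert_of_mem hx))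
      rcases hy' q (mem_insert_of_mem hqD) with h | h
      · exact h
      · by_contra hqy
        exact hpq.2 hpy (lt_of_le_not_ge h hqy)

lemma upSum_of_not_isMax (π : P → ℝ) {p : P} (hp : ¬ IsMax p) :
    upSum π p = π p * ∑ q ∈ univ.filter (p ⋖ ·), upSum π q := by
  have hnot : ∀ q D, p ⋖ q → D ∈ upChains q → p ∉ D := fun q D hpq hD hpD =>
    absurd ((mem_upChains.1 hD).2.1 p hpD) (not_le_of_gt hpq.lt)
  rw [upSum, upChains_of_not_isMax hp, sum_biUnion, mul_sum]
  · refine sum_congr rfl fun q hq => ?_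
    have hpq : p ⋖ q := by simpa using hq
    rw [sum_image, upSum, mul_sum]
    · exact sum_congr rfl fun D hD => prod_insert (hnot q D hpq hD)
    · intro D hD E hE h
      have := congrArg (fun C => C.erase p) h
      simpa [erase_insert (hnot q D hpq hD), erase_insert (hnot q E hpq hE)] using this
  · intro q hq q' hq' hne
    have hpq : p ⋖ q := by simpa using hq
    have hpq' : p ⋖ q' := by simpa using hq'
    refine disjoint_left.2 fun C hC hC' => hne ?_
    obtain ⟨D, hD, rfl⟩ := mem_image.1 hC
    obtain ⟨D', hD', h⟩ := mem_image.1 hC'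
    have h1 : q ∈ D' := by
      have : q ∈ insert p D' := h ▸ mem_insert_of_mem (self_mem_of_mem_upChains hD)
      exact (mem_insert.1 this).resolve_left hpq.lt.ne'
    have h2 : q' ∈ D := by
      have : q' ∈ insert p D := h ▸ mem_insert_of_mem (self_mem_of_mem_upChains hD')
      exact (mem_insert.1 this).resolve_left hpq'.lt.ne'
    exact le_antisymm ((mem_upChains.1 hD).2.1 _ h2) ((mem_upChains.1 hD').2.1 _ h1)

lemma downSum_of_isMin (π : P → ℝ) {p : P} (hp : IsMin p) : downSum π p = π p := by
  rw [downSum_eq_upSum_dual, upSum_of_isMax _ hp.toDual]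
  rfl

lemma downSum_of_not_isMin (π : P → ℝ) {p : P} (hp : ¬ IsMin p) :
    downSum π p = π p * ∑ q ∈ univ.filter (· ⋖ p), downSum π q := by
  rw [downSum_eq_upSum_dual, upSum_of_not_isMax _ (by simpa using hp)]
  congr 1
  refine Finset.sum_nbij' OrderDual.ofDual OrderDual.toDual ?_ ?_ ?_ ?_ ?_
  · intro a ha
    have : OrderDual.toDual p ⋖ a := by simpa using ha
    simpa using this.ofDual
  · intro a ha
    simpa using ha
  · intros; rfl
  · intros; rfl
  · intro a _
    rw [downSum_eq_upSum_dual]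
    rfl

lemma exists_mem_upChains (p : P) : ∃ C, C ∈ upChains p := by
  by_contra! h
  have h1 : ∀ q : P, upSum (fun _ => (1 : ℝ)) q = 0 → False := by
    intro q
    induction q using WellFoundedGT.induction with
    | ind q ih =>
      intro hq
      by_cases hm : IsMax q
      · rw [upSum_of_isMax _ hm] at hq
        norm_num at hq
      · rw [upSum_of_not_isMax _ hm, one_mul, sum_eq_zero_iff_of_nonneg] at hq
        · obtain ⟨z, hz⟩ := not_isMax_iff.1 hm
          obtain ⟨w, hw, -⟩ := exists_covBy_le_of_lt hz
          exact ih w hw.lt (hq w (by simpa using hw))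
        · intro i _
          exact sum_nonneg fun C _ => prod_nonneg fun _ _ => zero_le_one
  exact h1 p (by simp [upSum, eq_empty_of_forall_notMem h])

lemma upSum_pos {π : P → ℝ} (h : ∀ p, 0 < π p) (p : P) : 0 < upSum π p :=
  sum_pos (fun _ _ => prod_pos fun y _ => h y) (exists_mem_upChains p)

lemma downSum_pos {π : P → ℝ} (h : ∀ p, 0 < π p) (p : P) : 0 < downSum π p := by
  rw [downSum_eq_upSum_dual]
  exact upSum_pos (fun _ => h _) _

lemma isMaxChain_iff_forall {Q : Type} [PartialOrder Q] {C : Finset Q} :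
    IsMaxChain (· ≤ ·) (C : Set Q) ↔
      IsChain (· ≤ ·) (C : Set Q) ∧ ∀ y, (∀ x ∈ C, x ≤ y ∨ y ≤ x) → y ∈ C := by
  constructor
  · intro h
    refine ⟨h.1, fun y hy => ?_⟩
    have hc : IsChain (· ≤ ·) (insert y (C : Set Q)) :=
      h.1.insert fun x hx _ => (hy x hx).symm
    have := h.2 hc (Set.subset_insert y _)
    rw [← mem_coe, this]
    exact Set.mem_insert y _
  · rintro ⟨h, hm⟩
    refine ⟨h, fun t ht hCt => Set.Subset.antisymm hCt fun y hy => ?_⟩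
    exact hm y fun x hx => ht.total (hCt hx) hy

lemma chainSum_mul_self (π : P → ℝ) (p : P) :
    chainSum π p * π p = downSum π p * upSum π p := by
  rw [downSum, upSum, sum_mul_sum, ← sum_product', chainSum, sum_mul]
  have hinter : ∀ A B, A ∈ downChains p → B ∈ upChains p → A ∩ B = {p} := by
    intro A B hA hB
    ext x
    rw [mem_inter, mem_singleton]
    constructor
    · rintro ⟨h1, h2⟩
      exact le_antisymm ((mem_downChains.1 hA).2.1 x h1) ((mem_upChains.1 hB).2.1 x h2)
    · rintro rfl
      exact ⟨self_mem_of_mem_downChains hA, self_mem_of_mem_upChains hB⟩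
  have hsplit : ∀ C : Finset P, IsChain (· ≤ ·) (C : Set P) → p ∈ C →
      C.filter (· ≤ p) ∪ C.filter (p ≤ ·) = C := by
    intro C hC hp
    ext x
    simp only [mem_union, mem_filter]
    constructor
    · rintro (h | h) <;> exact h.1
    · intro hx
      rcases hC.total (mem_coe.2 hx) (mem_coe.2 hp) with h | h
      · exact Or.inl ⟨hx, h⟩
      · exact Or.inr ⟨hx, h⟩
  have hmem : ∀ C : Finset P, IsMaxChain (· ≤ ·) (C : Set P) → p ∈ C →
      C.filter (· ≤ p) ∈ downChains p ∧ C.filter (p ≤ ·) ∈ upChains p := by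
    intro C hC hp
    rw [isMaxChain_iff_forall] at hC
    rw [mem_upChains, mem_downChains]
    refine ⟨⟨hC.1.mono (coe_subset.2 (filter_subset _ _)), by simp, fun y hy hy' => ?_⟩,
      ⟨hC.1.mono (coe_subset.2 (filter_subset _ _)), by simp, fun y hy hy' => ?_⟩⟩
    · refine mem_filter.2 ⟨hC.2 y fun x hx => ?_, hy⟩
      rcases hC.1.total (mem_coe.2 hx) (mem_coe.2 hp) with h | h
      · exact (hy' x (mem_filter.2 ⟨hx, h⟩)).symm
      · exact Or.inr (hy.trans h)
    · refine mem_filter.2 ⟨hC.2 y fun x hx => ?_, hy⟩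
      rcases hC.1.total (mem_coe.2 hx) (mem_coe.2 hp) with h | h
      · exact Or.inl (h.trans hy)
      · exact hy' x (mem_filter.2 ⟨hx, h⟩)
  refine sum_bij' (fun C _ => (C.filter (· ≤ p), C.filter (p ≤ ·))) (fun AB _ => AB.1 ∪ AB.2)
    ?_ ?_ ?_ ?_ ?_
  · intro C hC
    rw [mem_filter] at hC
    exact mem_product.2 (hmem C hC.2.1 hC.2.2)
  · rintro ⟨A, B⟩ hAB
    obtain ⟨hA, hB⟩ := mem_product.1 hAB
    have hpA := self_mem_of_mem_downChains hA
    have hpB := self_mem_of_mem_upChains hB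
    rw [mem_upChains] at hB
    rw [mem_downChains] at hA
    refine mem_filter.2 ⟨mem_univ _, ?_, mem_union_left _ hpA⟩
    rw [isMaxChain_iff_forall]
    refine ⟨?_, fun y hy => ?_⟩
    · rw [coe_union]
      rintro x hx y hy hxy
      rcases hx with hx | hx <;> rcases hy with hy | hy
      · exact hA.1 hx hy hxy
      · exact Or.inl ((hA.2.1 x hx).trans (hB.2.1 y hy))
      · exact Or.inr ((hA.2.1 y hy).trans (hB.2.1 x hx))
      · exact hB.1 hx hy hxy
    · rcases hy p (mem_union_left _ hpA) with h | h
      · exact mem_union_right _ (hB.2.2 y h fun x hx => hy x (mem_union_right _ hx))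
      · exact mem_union_left _ (hA.2.2 y h fun x hx => (hy x (mem_union_left _ hx)).symm)
  · intro C hC
    rw [mem_filter] at hC
    exact hsplit C hC.2.1.1 hC.2.2
  · rintro ⟨A, B⟩ hAB
    obtain ⟨hA, hB⟩ := mem_product.1 hAB
    have hpA := self_mem_of_mem_downChains hA
    have hpB := self_mem_of_mem_upChains hB
    rw [mem_upChains] at hB
    rw [mem_downChains] at hA
    refine Prod.ext (Finset.ext fun x => ?_) (Finset.ext fun x => ?_)
    · simp only [mem_filter, mem_union]
      constructor
      · rintro ⟨h | h, hx⟩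
        · exact h
        · exact le_antisymm hx (hB.2.1 x h) ▸ hpA
      · exact fun h => ⟨Or.inl h, hA.2.1 x h⟩
    · simp only [mem_filter, mem_union]
      constructor
      · rintro ⟨h | h, hx⟩
        · exact le_antisymm (hA.2.1 x h) hx ▸ hpB
        · exact h
      · exact fun h => ⟨Or.inr h, hB.2.1 x h⟩
  · intro C hC
    rw [mem_filter] at hC
    obtain ⟨h1, h2⟩ := hmem C hC.2.1 hC.2.2
    rw [← prod_union_inter, hsplit C hC.2.1.1 hC.2.2, hinter _ _ h1 h2, prod_singleton]

lemma chainSum_comp_orderIso (e : P ≃o P) (π : P → ℝ) (p : P) :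
    chainSum (fun x => π (e x)) p = chainSum π (e p) := by
  have key : ∀ (f : P ≃o P) (C : Finset P), IsMaxChain (· ≤ ·) (C : Set P) →
      IsMaxChain (· ≤ ·) ((C.image f : Finset P) : Set P) := by
    intro f C hC
    rw [isMaxChain_iff_forall] at hC ⊢
    refine ⟨?_, fun y hy => mem_image.2 ⟨f.symm y, hC.2 _ fun x hx => ?_, by simp⟩⟩
    · rw [coe_image]
      rintro _ ⟨x, hx, rfl⟩ _ ⟨y, hy, rfl⟩ _
      simpa using hC.1.total hx hy
    · have := hy (f x) (mem_image_of_mem f hx)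
      rwa [← f.le_symm_apply, ← f.symm_apply_le] at this
  unfold chainSum
  refine sum_bij' (fun C _ => C.image e) (fun C _ => C.image e.symm) ?_ ?_ ?_ ?_ ?_
  · intro C hC
    rw [mem_filter] at hC ⊢
    exact ⟨mem_univ _, key e C hC.2.1, mem_image_of_mem e hC.2.2⟩
  · intro C hC
    rw [mem_filter] at hC ⊢
    exact ⟨mem_univ _, key e.symm C hC.2.1, mem_image.2 ⟨e p, hC.2.2, by simp⟩⟩
  · intro C _
    simp [image_image, Function.comp_def]
  · intro C _
    simp [image_image, Function.comp_def]
  · intro C _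
    rw [prod_image (by simp)]

end Chains

noncomputable section RankToggles

open Finset

variable {P : Type} [Fintype P] [PartialOrder P]

/-- The weighted number of maximal chains of `{x | x < p}`. -/
def strictDownSum (π : P → ℝ) (p : P) : ℝ :=
  if IsMin p then 1 else ∑ q ∈ univ.filter (· ⋖ p), downSum π q

lemma downSum_eq_mul_strictDownSum (π : P → ℝ) (p : P) :
    downSum π p = π p * strictDownSum π p := by
  unfold strictDownSum
  split_ifs with h
  · rw [downSum_of_isMin _ h, mul_one]
  · exact downSum_of_not_isMin _ h

lemma strictDownSum_pos {π : P → ℝ} (h : ∀ p, 0 < π p) (p : P) : 0 < strictDownSum π p := by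
  have := downSum_pos h p
  rw [downSum_eq_mul_strictDownSum] at this
  exact (pos_iff_pos_of_mul_pos this).1 (h p)

lemma strictDownSum_congr {π ρ : P → ℝ} {p : P} (h : ∀ x, x < p → π x = ρ x) :
    strictDownSum π p = strictDownSum ρ p := by
  unfold strictDownSum
  refine if_congr Iff.rfl rfl (sum_congr rfl fun q hq => ?_)
  have hq' : q ⋖ p := by simpa using hq
  exact downSum_congr fun x hx => h x (hx.trans_lt hq'.lt)

lemma chainSum_eq {π : P → ℝ} (h : ∀ p, 0 < π p) (p : P) :
    chainSum π p = strictDownSum π p * upSum π p := by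
  have := chainSum_mul_self π p
  rw [downSum_eq_mul_strictDownSum] at this
  exact mul_right_cancel₀ (h p).ne' (by linarith)

variable {κ : ℝ} {rk : P → ℕ}

lemma arankToggleB_pos (hκ : 0 < κ) (i : ℕ) {π : P → ℝ} (h : ∀ p, 0 < π p) (p : P) :
    0 < arankToggleB κ rk i π p := by
  unfold arankToggleB
  split_ifs
  · rw [chainSum_eq h]
    exact div_pos hκ (mul_pos (strictDownSum_pos h p) (upSum_pos h p))
  · exact h p

lemma aApplyB_pos (hκ : 0 < κ) (w : List ℕ) {π : P → ℝ} (h : ∀ p, 0 < π p) (p : P) :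
    0 < aApplyB κ rk w π p := by
  induction w generalizing p with
  | nil => exact h p
  | cons i w ih => exact arankToggleB_pos hκ i ih p

lemma downSum_arankToggleB (hrk : StrictMono rk) {π : P → ℝ} (h : ∀ p, 0 < π p) (p : P) :
    downSum (arankToggleB κ rk (rk p) π) p = κ / upSum π p := by
  have h1 : strictDownSum (arankToggleB κ rk (rk p) π) p = strictDownSum π p :=
    strictDownSum_congr fun x hx => if_neg (hrk hx).ne
  rw [downSum_eq_mul_strictDownSum, h1]
  simp only [arankToggleB, if_true]
  rw [chainSum_eq h]
  have := (strictDownSum_pos h p).ne'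
  have := (upSum_pos h p).ne'
  field_simp

/-- The result of toggling the ranks `m, m + 1, …, m + l - 1`, in that order. -/
lemma aApplyB_range'_reverse (hκ : 0 < κ) (hrk : StrictMono rk) {π : P → ℝ}
    (h : ∀ p, 0 < π p) (m l : ℕ) (p : P) :
    ((rk p < m ∨ m + l ≤ rk p) → aApplyB κ rk (List.range' m l).reverse π p = π p) ∧
    (m ≤ rk p → rk p < m + l →
      downSum (aApplyB κ rk (List.range' m l).reverse π) p = κ / upSum π p) := by
  induction l generalizing p with
  | zero =>
    refine ⟨fun _ => rfl, fun h1 h2 => ?_⟩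
    omega
  | succ l ih =>
    rw [List.range'_1_concat, List.reverse_append, List.reverse_singleton,
      List.singleton_append]
    have hpos := aApplyB_pos (rk := rk) hκ (List.range' m l).reverse h
    simp only [aApplyB]
    set σ := aApplyB κ rk (List.range' m l).reverse π with hσ
    constructor
    · intro hp
      rw [arankToggleB, if_neg (by omega)]
      exact (ih p).1 (by omega)
    · intro h1 h2
      by_cases hp : rk p = m + l
      · rw [← hp, downSum_arankToggleB hrk hpos]
        congr 1
        exact upSum_congr fun x hx => (ih x).1 (Or.inr (hp ▸ hrk.monotone hx))
      · rw [← (ih p).2 h1 (by omega)]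
        refine downSum_congr fun x hx => if_neg ?_
        have := hrk.monotone hx
        omega

/-- The state reached after the first `m` antichain rowmotion passes of rowvacuation, where
pass number `m` toggles the ranks `m, m + 1, …, r`. -/
def passState (κ : ℝ) (rk : P → ℕ) (r : ℕ) (π : P → ℝ) : ℕ → P → ℝ
  | 0 => π
  | m + 1 => aApplyB κ rk (List.range' m (r + 1 - m)).reverse (passState κ rk r π m)

lemma aApplyB_append (w v : List ℕ) (π : P → ℝ) :
    aApplyB κ rk (w ++ v) π = aApplyB κ rk w (aApplyB κ rk v π) := by
  induction w with
  | nil => rfl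
  | cons i w ih => simp only [List.cons_append, aApplyB, ih]

lemma aApplyB_foldr (f : ℕ → List ℕ) (w v : List ℕ) (π : P → ℝ) :
    aApplyB κ rk (w.foldr (fun k acc => f k ++ acc) v) π =
      aApplyB κ rk (w.foldr (fun k acc => f k ++ acc) []) (aApplyB κ rk v π) := by
  induction w with
  | nil => rfl
  | cons i w ih => simp only [List.foldr_cons, aApplyB_append, ih]

lemma RvacAB_eq_passState (r : ℕ) (π : P → ℝ) :
    RvacAB κ rk r π = passState κ rk r π (r + 1) := by
  have key : ∀ t, t ≤ r + 1 →
      aApplyB κ rk ((List.range t).foldr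
        (fun k acc => (List.range (r + 1)).reverse.take (k + 1) ++ acc) [])
        (passState κ rk r π (r + 1 - t)) = passState κ rk r π (r + 1) := by
    intro t
    induction t with
    | zero => intro _; rfl
    | succ t ih =>
      intro ht
      rw [List.range_succ (n := t), List.foldr_append, aApplyB_foldr, ← ih (by omega)]
      congr 1
      have h1 : r + 1 - t = (r + 1 - (t + 1)) + 1 := by omega
      rw [h1, passState]
      congr 1
      simp only [List.foldr_cons, List.foldr_nil, List.append_nil]
      rw [List.take_reverse, List.length_range, List.range_eq_range', List.drop_range']
      congr 2
      omega
  have := key (r + 1) le_rfl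
  rwa [Nat.sub_self] at this

section Passes

variable {r : ℕ} {π : P → ℝ}

lemma passState_pos (hκ : 0 < κ) (h : ∀ p, 0 < π p) (m : ℕ) (p : P) :
    0 < passState κ rk r π m p := by
  induction m generalizing p with
  | zero => exact h p
  | succ m ih => exact aApplyB_pos hκ _ ih p

lemma passState_succ_of_lt (hκ : 0 < κ) (hrk : StrictMono rk) (h : ∀ p, 0 < π p)
    {m : ℕ} {p : P} (hp : rk p < m) :
    passState κ rk r π (m + 1) p = passState κ rk r π m p :=
  (aApplyB_range'_reverse hκ hrk (passState_pos hκ h m) m _ p).1 (Or.inl hp)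

lemma downSum_passState_succ (hκ : 0 < κ) (hrk : StrictMono rk) (hr : ∀ p, rk p ≤ r)
    (h : ∀ p, 0 < π p) {m : ℕ} {p : P} (hp : m ≤ rk p) :
    downSum (passState κ rk r π (m + 1)) p = κ / upSum (passState κ rk r π m) p :=
  (aApplyB_range'_reverse hκ hrk (passState_pos hκ h m) m _ p).2 hp (by have := hr p; omega)

lemma RvacAB_apply (hκ : 0 < κ) (hrk : StrictMono rk) (hr : ∀ p, rk p ≤ r)
    (h : ∀ p, 0 < π p) (p : P) :
    RvacAB κ rk r π p = passState κ rk r π (rk p + 1) p := by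
  rw [RvacAB_eq_passState]
  have : ∀ d, passState κ rk r π (rk p + 1 + d) p = passState κ rk r π (rk p + 1) p := by
    intro d
    induction d with
    | zero => rfl
    | succ d ih => rw [← ih, ← add_assoc, passState_succ_of_lt hκ hrk h (by omega)]
  rw [← this (r - rk p)]
  have := hr p
  congr 1
  omega

lemma RvacAB_apply_of_isMin (hκ : 0 < κ) (hrk : StrictMono rk) (hr : ∀ p, rk p ≤ r)
    (h : ∀ p, 0 < π p) {p : P} (hp : IsMin p) (hp0 : rk p = 0) :
    RvacAB κ rk r π p = κ / upSum π p := by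
  rw [RvacAB_apply hκ hrk hr h, ← downSum_of_isMin (passState κ rk r π (rk p + 1)) hp, hp0,
    downSum_passState_succ hκ hrk hr h (Nat.zero_le _)]
  rfl

/-- Above the frozen ranks, a pass acts by rowmotion. -/
lemma passState_succ_apply (hκ : 0 < κ) (hrk : StrictMono rk) (hr : ∀ p, rk p ≤ r)
    (hcov : ∀ p q : P, p ⋖ q → rk q = rk p + 1)
    (h : ∀ p, 0 < π p) {m : ℕ} {p : P} (hp : ¬ IsMin p) (hm : m + 1 ≤ rk p) :
    passState κ rk r π (m + 1) p * (upSum (passState κ rk r π m) p *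
      ∑ q ∈ univ.filter (· ⋖ p), (upSum (passState κ rk r π m) q)⁻¹) = 1 := by
  have h1 := downSum_passState_succ (π := π) hκ hrk hr h (m := m) (p := p) (by omega)
  rw [downSum_of_not_isMin _ hp] at h1
  have h2 : ∑ q ∈ univ.filter (· ⋖ p), downSum (passState κ rk r π (m + 1)) q =
      κ * ∑ q ∈ univ.filter (· ⋖ p), (upSum (passState κ rk r π m) q)⁻¹ := by
    rw [mul_sum]
    refine sum_congr rfl fun q hq => ?_
    have := hcov q p (by simpa using hq)
    rw [downSum_passState_succ hκ hrk hr h (by omega), div_eq_mul_inv]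
  rw [h2] at h1
  have := (upSum_pos (passState_pos (rk := rk) (r := r) hκ h m) p).ne'
  generalize ∑ q ∈ univ.filter (· ⋖ p), (upSum (passState κ rk r π m) q)⁻¹ = s at h1 ⊢
  field_simp at h1
  linarith

lemma RvacAB_apply_of_rk_eq_succ (hκ : 0 < κ) (hrk : StrictMono rk) (hr : ∀ p, rk p ≤ r)
    (hcov : ∀ p q : P, p ⋖ q → rk q = rk p + 1)
    (h : ∀ p, 0 < π p) {m : ℕ} {p : P} (hp : ¬ IsMin p) (hm : rk p = m + 1) :
    RvacAB κ rk r π p * (upSum (passState κ rk r π (m + 1)) p *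
      ∑ q ∈ univ.filter (· ⋖ p), (upSum (passState κ rk r π m) q)⁻¹) = 1 := by
  rw [RvacAB_apply hκ hrk hr h, hm]
  have h1 := downSum_passState_succ (π := π) hκ hrk hr h (m := m + 1) (p := p) hm.ge
  rw [downSum_of_not_isMin _ hp] at h1
  have h2 : ∑ q ∈ univ.filter (· ⋖ p), downSum (passState κ rk r π (m + 1 + 1)) q =
      κ * ∑ q ∈ univ.filter (· ⋖ p), (upSum (passState κ rk r π m) q)⁻¹ := by
    rw [mul_sum]
    refine sum_congr rfl fun q hq => ?_
    have hq' := hcov q p (by simpa using hq)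
    rw [← div_eq_mul_inv, ← downSum_passState_succ (r := r) hκ hrk hr h (by omega)]
    refine downSum_congr fun x hx => passState_succ_of_lt hκ hrk h ?_
    have := hrk.monotone hx
    omega
  rw [h2] at h1
  have := (upSum_pos (passState_pos (rk := rk) (r := r) hκ h (m + 1)) p).ne'
  generalize ∑ q ∈ univ.filter (· ⋖ p), (upSum (passState κ rk r π m) q)⁻¹ = s at h1 ⊢
  field_simp at h1
  linarith

end Passes

lemma aApplyB_comp_orderIso (e : P ≃o P) (he : ∀ p, rk (e p) = rk p) (w : List ℕ)
    (π : P → ℝ) (p : P) :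
    aApplyB κ rk w (fun x => π (e x)) p = aApplyB κ rk w π (e p) := by
  induction w generalizing p with
  | nil => rfl
  | cons i w ih =>
    simp only [aApplyB, arankToggleB, he]
    rw [funext ih, chainSum_comp_orderIso]

end RankToggles

section IntervalPoset

open Finset

variable {n : ℕ}

/-- The left endpoint of an interval. -/
def AnP.lo (p : AnP n) : ℕ := p.val.1

/-- The right endpoint of an interval. -/
def AnP.hi (p : AnP n) : ℕ := p.val.2

/-- The interval `[i, j]` as an element of `Aⁿ`. -/
def AnP.mk {i j : ℕ} (h : 1 ≤ i ∧ i ≤ j ∧ j ≤ n) : AnP n := ⟨(i, j), h⟩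

@[simp] lemma AnP.lo_mk {i j : ℕ} (h : 1 ≤ i ∧ i ≤ j ∧ j ≤ n) : (AnP.mk h).lo = i := rfl

@[simp] lemma AnP.hi_mk {i j : ℕ} (h : 1 ≤ i ∧ i ≤ j ∧ j ≤ n) : (AnP.mk h).hi = j := rfl

lemma AnP.bounds (p : AnP n) : 1 ≤ p.lo ∧ p.lo ≤ p.hi ∧ p.hi ≤ n := p.2

lemma AnP.le_iff {x y : AnP n} : x ≤ y ↔ y.lo ≤ x.lo ∧ x.hi ≤ y.hi := Iff.rfl

lemma AnP.lt_iff {x y : AnP n} : x < y ↔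
    (y.lo ≤ x.lo ∧ x.hi ≤ y.hi) ∧ ¬ (x.lo ≤ y.lo ∧ y.hi ≤ x.hi) := lt_iff_le_not_ge

lemma AnP.eq_of_lo_eq_of_hi_eq {x y : AnP n} (h1 : x.lo = y.lo) (h2 : x.hi = y.hi) : x = y :=
  Subtype.ext (Prod.ext h1 h2)

lemma rkAn_apply (p : AnP n) : rkAn n p = p.hi - p.lo := rfl

lemma rkAn_strictMono : StrictMono (rkAn n) := by
  intro x y h
  have h1 := x.bounds
  have h2 := y.bounds
  rw [AnP.lt_iff] at h
  rw [rkAn_apply, rkAn_apply]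
  omega

lemma rkAn_le (p : AnP n) : rkAn n p ≤ n - 1 := by
  have := p.bounds
  rw [rkAn_apply]
  omega

lemma AnP.isMin_iff {x : AnP n} : IsMin x ↔ x.lo = x.hi := by
  have hx := x.bounds
  constructor
  · intro h
    have h0 : 1 ≤ x.lo ∧ x.lo ≤ x.lo ∧ x.lo ≤ n := by omega
    have h1 := AnP.le_iff.1 (h (b := AnP.mk h0) (AnP.le_iff.2 (by simpa using hx.2.1)))
    simp only [AnP.lo_mk, AnP.hi_mk] at h1
    omega
  · intro h y hy
    have := y.bounds
    rw [AnP.le_iff] at hy ⊢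
    omega

lemma AnP.isMax_iff {x : AnP n} : IsMax x ↔ x.lo = 1 ∧ x.hi = n := by
  have hx := x.bounds
  constructor
  · intro h
    have h0 : 1 ≤ 1 ∧ 1 ≤ n ∧ n ≤ n := by omega
    have h1 := AnP.le_iff.1 (h (b := AnP.mk h0)
      (AnP.le_iff.2 (by simp only [AnP.lo_mk, AnP.hi_mk]; omega)))
    simp only [AnP.lo_mk, AnP.hi_mk] at h1
    omega
  · intro h y hy
    have := y.bounds
    rw [AnP.le_iff] at hy ⊢
    omega

lemma AnP.covBy_iff {x y : AnP n} : x ⋖ y ↔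
    (y.lo = x.lo ∧ y.hi = x.hi + 1) ∨ (y.lo + 1 = x.lo ∧ y.hi = x.hi) := by
  have hx := x.bounds
  have hy := y.bounds
  constructor
  · intro h
    have hlt := AnP.lt_iff.1 h.lt
    by_cases hc : y.lo < x.lo
    · have h0 : 1 ≤ x.lo - 1 ∧ x.lo - 1 ≤ x.hi ∧ x.hi ≤ n := by omega
      have h1 := mt AnP.lt_iff.2 (h.2 (c := AnP.mk h0)
        (AnP.lt_iff.2 (by simp only [AnP.lo_mk, AnP.hi_mk]; omega)))
      simp only [AnP.lo_mk, AnP.hi_mk] at h1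
      omega
    · have h0 : 1 ≤ x.lo ∧ x.lo ≤ x.hi + 1 ∧ x.hi + 1 ≤ n := by omega
      have h1 := mt AnP.lt_iff.2 (h.2 (c := AnP.mk h0)
        (AnP.lt_iff.2 (by simp only [AnP.lo_mk, AnP.hi_mk]; omega)))
      simp only [AnP.lo_mk, AnP.hi_mk] at h1
      omega
  · intro h
    refine ⟨AnP.lt_iff.2 (by omega), fun z h1 h2 => ?_⟩
    rw [AnP.lt_iff] at h1 h2
    omega

lemma rkAn_covBy (p q : AnP n) (h : p ⋖ q) : rkAn n q = rkAn n p + 1 := by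
  have := p.bounds
  have := q.bounds
  rw [AnP.covBy_iff] at h
  rw [rkAn_apply, rkAn_apply]
  omega

/-- The extension by zero of a function on `Aⁿ` to pairs of natural numbers. -/
def extendByZero (f : AnP n → ℝ) (i j : ℕ) : ℝ :=
  if h : 1 ≤ i ∧ i ≤ j ∧ j ≤ n then f (AnP.mk h) else 0

lemma extendByZero_of_mem (f : AnP n → ℝ) {i j : ℕ} (h : 1 ≤ i ∧ i ≤ j ∧ j ≤ n) :
    extendByZero f i j = f (AnP.mk h) := dif_pos h

lemma extendByZero_val (f : AnP n → ℝ) (p : AnP n) :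
    extendByZero f p.lo p.hi = f p :=
  extendByZero_of_mem f p.bounds

lemma extendByZero_of_not_mem (f : AnP n → ℝ) {i j : ℕ} (h : ¬ (1 ≤ i ∧ i ≤ j ∧ j ≤ n)) :
    extendByZero f i j = 0 := dif_neg h

lemma extendByZero_inv (f : AnP n → ℝ) (i j : ℕ) :
    extendByZero (fun p => (f p)⁻¹) i j = (extendByZero f i j)⁻¹ := by
  unfold extendByZero
  split_ifs <;> simp

lemma extendByZero_eq_sum (f : AnP n → ℝ) (i j : ℕ) :
    extendByZero f i j = ∑ q : AnP n, if q.lo = i ∧ q.hi = j then f q else 0 := by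
  by_cases h : 1 ≤ i ∧ i ≤ j ∧ j ≤ n
  · rw [extendByZero_of_mem f h, sum_eq_single (AnP.mk h)]
    · simp
    · intro b _ hb
      rw [if_neg]
      exact fun hb' => hb (AnP.eq_of_lo_eq_of_hi_eq hb'.1 hb'.2)
    · exact fun h' => absurd (mem_univ _) h'
  · rw [extendByZero_of_not_mem f h, sum_eq_zero]
    intro q _
    rw [if_neg]
    have := q.bounds
    omega

lemma sum_upper_covers (f : AnP n → ℝ) (p : AnP n) :
    ∑ q ∈ univ.filter (p ⋖ ·), f q =
      extendByZero f (p.lo - 1) p.hi + extendByZero f p.lo (p.hi + 1) := by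
  rw [sum_filter, extendByZero_eq_sum, extendByZero_eq_sum, ← sum_add_distrib]
  refine sum_congr rfl fun q _ => ?_
  rw [AnP.covBy_iff]
  have := p.bounds
  have := q.bounds
  split_ifs <;> first | omega | simp

lemma sum_lower_covers (f : AnP n → ℝ) (p : AnP n) (hp : p.lo < p.hi) :
    ∑ q ∈ univ.filter (· ⋖ p), f q =
      extendByZero f (p.lo + 1) p.hi + extendByZero f p.lo (p.hi - 1) := by
  rw [sum_filter, extendByZero_eq_sum, extendByZero_eq_sum, ← sum_add_distrib]
  refine sum_congr rfl fun q _ => ?_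
  rw [AnP.covBy_iff]
  have := p.bounds
  have := q.bounds
  split_ifs <;> first | omega | simp

lemma prod_AnP_rows (g : ℕ → ℕ → ℝ) :
    ∏ p : AnP n, g p.lo p.hi = ∏ i ∈ Icc 1 n, ∏ j ∈ Ico i (n + 1), g i j := by
  rw [prod_sigma']
  refine prod_bij (fun p _ => ⟨p.lo, p.hi⟩) ?_ ?_ ?_ ?_
  · intro p _
    have := p.bounds
    simp only [mem_sigma, mem_Icc, mem_Ico]
    omega
  · intro p _ q _ h
    simp only [Sigma.mk.injEq, heq_eq_eq] at h
    exact AnP.eq_of_lo_eq_of_hi_eq h.1 h.2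
  · rintro ⟨i, j⟩ h
    simp only [mem_sigma, mem_Icc, mem_Ico] at h
    exact ⟨AnP.mk (i := i) (j := j) (by omega), mem_univ _, rfl⟩
  · intros
    rfl

lemma prod_AnP_columns (g : ℕ → ℕ → ℝ) :
    ∏ p : AnP n, g p.lo p.hi = ∏ j ∈ Icc 1 n, ∏ k ∈ range j, g (j - k) j := by
  rw [prod_sigma']
  refine prod_bij (fun p _ => ⟨p.hi, p.hi - p.lo⟩) ?_ ?_ ?_ ?_
  · intro p _
    have := p.bounds
    simp only [mem_sigma, mem_Icc, mem_range]
    omega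
  · intro p _ q _ h
    have := p.bounds
    have := q.bounds
    simp only [Sigma.mk.injEq, heq_eq_eq] at h
    exact AnP.eq_of_lo_eq_of_hi_eq (by omega) (by omega)
  · rintro ⟨j, k⟩ h
    simp only [mem_sigma, mem_Icc, mem_range] at h
    refine ⟨AnP.mk (i := j - k) (j := j) (by omega), mem_univ _, ?_⟩
    simp only [AnP.lo_mk, AnP.hi_mk, Sigma.mk.injEq, heq_eq_eq, true_and]
    omega
  · intro p _
    have := p.bounds
    simp only
    congr 1
    omega

lemma AnP.reflect_bounds (p : AnP n) :
    1 ≤ n + 1 - p.hi ∧ n + 1 - p.hi ≤ n + 1 - p.lo ∧ n + 1 - p.lo ≤ n := by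
  have := p.bounds
  omega

/-- The reflection `[i, j] ↦ [n + 1 - j, n + 1 - i]` of `Aⁿ`. -/
def AnP.reflect (n : ℕ) : AnP n ≃o AnP n where
  toFun p := AnP.mk p.reflect_bounds
  invFun p := AnP.mk p.reflect_bounds
  left_inv p := by
    have := p.bounds
    refine AnP.eq_of_lo_eq_of_hi_eq ?_ ?_ <;> simp only [AnP.lo_mk, AnP.hi_mk] <;> omega
  right_inv p := by
    have := p.bounds
    refine AnP.eq_of_lo_eq_of_hi_eq ?_ ?_ <;> simp only [AnP.lo_mk, AnP.hi_mk] <;> omega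
  map_rel_iff' := by
    intro p q
    have := p.bounds
    have := q.bounds
    change n + 1 - q.hi ≤ n + 1 - p.hi ∧ n + 1 - p.lo ≤ n + 1 - q.lo ↔
      q.lo ≤ p.lo ∧ p.hi ≤ q.hi
    omega

lemma AnP.lo_reflect (p : AnP n) : (AnP.reflect n p).lo = n + 1 - p.hi := rfl

lemma AnP.hi_reflect (p : AnP n) : (AnP.reflect n p).hi = n + 1 - p.lo := rfl

lemma rkAn_reflect (p : AnP n) : rkAn n (AnP.reflect n p) = rkAn n p := by
  have := p.bounds
  rw [rkAn_apply, rkAn_apply, AnP.lo_reflect, AnP.hi_reflect]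
  omega

end IntervalPoset

noncomputable section LalanneKreweras

open Finset

variable {n : ℕ} {κ : ℝ} {π : AnP n → ℝ}

/-- The state `passState` for `Aⁿ`, extended by zero. -/
def passExt (n : ℕ) (κ : ℝ) (π : AnP n → ℝ) (m : ℕ) : ℕ → ℕ → ℝ :=
  extendByZero (passState κ (rkAn n) (n - 1) π m)

/-- The upward chain sums of `passState` for `Aⁿ`, extended by zero. -/
def passUpSum (n : ℕ) (κ : ℝ) (π : AnP n → ℝ) (m : ℕ) : ℕ → ℕ → ℝ :=
  extendByZero (upSum (passState κ (rkAn n) (n - 1) π m))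

lemma passUpSum_pos (hκ : 0 < κ) (hπ : ∀ p, 0 < π p) (m : ℕ) {i j : ℕ}
    (h : 1 ≤ i ∧ i ≤ j ∧ j ≤ n) : 0 < passUpSum n κ π m i j := by
  rw [passUpSum, extendByZero_of_mem _ h]
  exact upSum_pos (passState_pos hκ hπ m) _

lemma passUpSum_eq_zero (m : ℕ) {i j : ℕ} (h : ¬ (1 ≤ i ∧ i ≤ j ∧ j ≤ n)) :
    passUpSum n κ π m i j = 0 := extendByZero_of_not_mem _ h

lemma passUpSum_eq_mul (m : ℕ) {i j : ℕ} (h : 1 ≤ i ∧ i ≤ j ∧ j ≤ n)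
    (hne : ¬ (i = 1 ∧ j = n)) :
    passUpSum n κ π m i j = passExt n κ π m i j *
      (passUpSum n κ π m (i - 1) j + passUpSum n κ π m i (j + 1)) := by
  rw [passUpSum, passExt, extendByZero_of_mem _ h, extendByZero_of_mem _ h,
    upSum_of_not_isMax _ (by rwa [AnP.isMax_iff]), sum_upper_covers, AnP.lo_mk, AnP.hi_mk]

lemma passUpSum_top (m : ℕ) (hn : 1 ≤ n) :
    passUpSum n κ π m 1 n = passExt n κ π m 1 n := by
  rw [passUpSum, passExt, extendByZero_of_mem _ ⟨le_rfl, hn, le_rfl⟩,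
    extendByZero_of_mem _ ⟨le_rfl, hn, le_rfl⟩,
    upSum_of_isMax _ (by rw [AnP.isMax_iff]; exact ⟨rfl, rfl⟩)]

lemma passExt_succ (hκ : 0 < κ) (hπ : ∀ p, 0 < π p) {m i j : ℕ}
    (hi : 1 ≤ i) (hij : i + m ≤ j) (hj : j + 1 ≤ n) :
    passExt n κ π (m + 1) i (j + 1) * (passUpSum n κ π m i (j + 1) *
      (passUpSum n κ π m i j + passUpSum n κ π m (i + 1) (j + 1))) =
      passUpSum n κ π m i j * passUpSum n κ π m (i + 1) (j + 1) := by
  have hv : 1 ≤ i ∧ i ≤ j + 1 ∧ j + 1 ≤ n := by omega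
  have h := passState_succ_apply (r := n - 1) hκ rkAn_strictMono rkAn_le rkAn_covBy hπ
    (m := m) (p := AnP.mk hv) (by rw [AnP.isMin_iff, AnP.lo_mk, AnP.hi_mk]; omega)
    (by rw [rkAn_apply, AnP.lo_mk, AnP.hi_mk]; omega)
  rw [sum_lower_covers _ _ (by rw [AnP.lo_mk, AnP.hi_mk]; omega), AnP.lo_mk, AnP.hi_mk,
    extendByZero_inv, extendByZero_inv,
    ← extendByZero_of_mem (upSum (passState κ (rkAn n) (n - 1) π m)) hv,
    ← extendByZero_of_mem (passState κ (rkAn n) (n - 1) π (m + 1)) hv] at h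
  change passExt n κ π (m + 1) i (j + 1) * (passUpSum n κ π m i (j + 1) *
    ((passUpSum n κ π m (i + 1) (j + 1))⁻¹ + (passUpSum n κ π m i j)⁻¹)) = 1 at h
  have h1 := passUpSum_pos hκ hπ m (i := i + 1) (j := j + 1) (by omega)
  have h2 := passUpSum_pos hκ hπ m (i := i) (j := j) (by omega)
  field_simp at h
  linarith

lemma LKB_diag (hκ : 0 < κ) (hπ : ∀ p, 0 < π p) {i : ℕ} (hi : 1 ≤ i) (hin : i ≤ n) :
    extendByZero (LKB n κ π) i i * passUpSum n κ π 0 i i = κ := by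
  have hv : 1 ≤ i ∧ i ≤ i ∧ i ≤ n := by omega
  have h := RvacAB_apply_of_isMin (r := n - 1) hκ rkAn_strictMono rkAn_le hπ
    (p := AnP.mk hv) (by rw [AnP.isMin_iff, AnP.lo_mk, AnP.hi_mk])
    (by simp [rkAn_apply])
  rw [extendByZero_of_mem _ hv, LKB, h, passUpSum, extendByZero_of_mem _ hv]
  exact div_mul_cancel₀ _ (upSum_pos hπ _).ne'

lemma LKB_off_diag (hκ : 0 < κ) (hπ : ∀ p, 0 < π p) {m i : ℕ}
    (hi : 1 ≤ i) (hin : i + m + 1 ≤ n) :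
    extendByZero (LKB n κ π) i (i + m + 1) * (passUpSum n κ π (m + 1) i (i + m + 1) *
      (passUpSum n κ π m i (i + m) + passUpSum n κ π m (i + 1) (i + m + 1))) =
      passUpSum n κ π m i (i + m) * passUpSum n κ π m (i + 1) (i + m + 1) := by
  have hv : 1 ≤ i ∧ i ≤ i + m + 1 ∧ i + m + 1 ≤ n := by omega
  have h := RvacAB_apply_of_rk_eq_succ (r := n - 1) hκ rkAn_strictMono rkAn_le rkAn_covBy hπ
    (m := m) (p := AnP.mk hv) (by rw [AnP.isMin_iff, AnP.lo_mk, AnP.hi_mk]; omega)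
    (by rw [rkAn_apply, AnP.lo_mk, AnP.hi_mk]; omega)
  rw [sum_lower_covers _ _ (by rw [AnP.lo_mk, AnP.hi_mk]; omega), AnP.lo_mk, AnP.hi_mk,
    extendByZero_inv, extendByZero_inv,
    ← extendByZero_of_mem (upSum (passState κ (rkAn n) (n - 1) π (m + 1))) hv,
    ← extendByZero_of_mem (RvacAB κ (rkAn n) (n - 1) π) hv] at h
  change extendByZero (LKB n κ π) i (i + m + 1) * (passUpSum n κ π (m + 1) i (i + m + 1) *
    ((passUpSum n κ π m (i + 1) (i + m + 1))⁻¹ + (passUpSum n κ π m i (i + m))⁻¹)) = 1 at h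
  have h1 := passUpSum_pos hκ hπ m (i := i + 1) (j := i + m + 1) (by omega)
  have h2 := passUpSum_pos hκ hπ m (i := i) (j := i + m) (by omega)
  field_simp at h
  linarith

/-- The product of row `i` of the state after `m` passes, over the elements of rank `≥ m`. -/
def rowProd (n : ℕ) (κ : ℝ) (π : AnP n → ℝ) (m i : ℕ) : ℝ :=
  ∏ j ∈ Ico (i + m) (n + 1), passExt n κ π m i j

lemma rowProd_succ (hκ : 0 < κ) (hπ : ∀ p, 0 < π p) {m i : ℕ}
    (hi : 1 ≤ i) (hin : i + m + 1 ≤ n) :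
    rowProd n κ π (m + 1) i *
      (passUpSum n κ π m i (i + m) + passUpSum n κ π m (i + 1) (i + m + 1)) =
      rowProd n κ π m (i + 1) * passUpSum n κ π m i (i + m) := by
  set a := passUpSum n κ π m i with ha
  set b := passUpSum n κ π m (i + 1) with hb
  have key : ∀ d, i + m + d ≤ n →
      (∏ j ∈ Ico (i + m + 1) (i + m + d + 1), passExt n κ π (m + 1) i j) *
        (a (i + m) + b (i + m + 1)) * a (i + m + d) =
      (∏ j ∈ Ico (i + m + 1) (i + m + d + 1), passExt n κ π m (i + 1) j) *
        a (i + m) * (a (i + m + d) + b (i + m + d + 1)) := by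
    intro d
    induction d with
    | zero =>
      intro _
      simp
      ring
    | succ d ih =>
      intro hd
      have ih := ih (by omega)
      rw [show i + m + (d + 1) = i + m + d + 1 from rfl,
        prod_Ico_succ_top (b := i + m + d + 1) (by omega),
        prod_Ico_succ_top (b := i + m + d + 1) (by omega)]
      set t := i + m + d with ht
      have h1 := passExt_succ hκ hπ (m := m) (i := i) (j := t) hi (by omega) (by omega)
      have h2 := passUpSum_eq_mul (κ := κ) (π := π) m (i := i + 1) (j := t + 1)
        (by omega) (by omega)
      rw [Nat.add_sub_cancel] at h2
      rw [← ha, ← hb] at h1 h2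
      have h3 : 0 < a t := passUpSum_pos hκ hπ m (by omega)
      refine mul_right_cancel₀ h3.ne' ?_
      linear_combination (passExt n κ π (m + 1) i (t + 1) * a (t + 1)) * ih +
        (∏ j ∈ Ico (i + m + 1) (t + 1), passExt n κ π m (i + 1) j) * a (i + m) * h1 +
        (∏ j ∈ Ico (i + m + 1) (t + 1), passExt n κ π m (i + 1) j) * a (i + m) * a t * h2
  have h := key (n - (i + m)) (by omega)
  rw [show i + m + (n - (i + m)) = n by omega] at h
  have hb0 : b (n + 1) = 0 := passUpSum_eq_zero m (by omega)
  have h3 : 0 < a n := passUpSum_pos hκ hπ m (by omega)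
  rw [hb0, add_zero] at h
  rw [rowProd, rowProd, show i + (m + 1) = i + m + 1 by omega,
    show i + 1 + m = i + m + 1 by omega]
  exact mul_right_cancel₀ h3.ne' h

lemma rowProd_one {m : ℕ} (hm : 1 + m ≤ n) :
    rowProd n κ π m 1 = passUpSum n κ π m 1 (1 + m) := by
  have key : ∀ d, 1 + m + d ≤ n →
      (∏ j ∈ Ico (1 + m) (1 + m + d), passExt n κ π m 1 j) * passUpSum n κ π m 1 (1 + m + d) =
        passUpSum n κ π m 1 (1 + m) := by
    intro d
    induction d with
    | zero => simp
    | succ d ih =>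
      intro hd
      rw [← ih (by omega), show 1 + m + (d + 1) = 1 + m + d + 1 from rfl,
        prod_Ico_succ_top (by omega),
        passUpSum_eq_mul (κ := κ) (π := π) m (i := 1) (j := 1 + m + d) (by omega) (by omega),
        passUpSum_eq_zero m (i := 1 - 1) (by omega)]
      ring
  have h := key (n - (1 + m)) (by omega)
  rw [show 1 + m + (n - (1 + m)) = n by omega, passUpSum_top m (by omega)] at h
  rw [rowProd, prod_Ico_succ_top hm, h]

lemma rowProd_mul_column (hκ : 0 < κ) (hπ : ∀ p, 0 < π p) {i : ℕ} (hin : i ≤ n) (m : ℕ)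
    (hm : m + 1 ≤ i) :
    rowProd n κ π 0 i * (∏ k ∈ range (m + 1), extendByZero (LKB n κ π) (i - k) i) *
      passUpSum n κ π m (i - m) i = κ * rowProd n κ π m (i - m) := by
  induction m with
  | zero =>
    have := LKB_diag hκ hπ hm hin
    simp only [zero_add, prod_range_one, Nat.sub_zero]
    linear_combination rowProd n κ π 0 i * this
  | succ m ih =>
    have ih := ih (by omega)
    rw [prod_range_succ]
    obtain ⟨a, rfl⟩ : ∃ a, i = a + m + 1 := ⟨i - m - 1, by omega⟩
    rw [show a + m + 1 - m = a + 1 by omega] at ih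
    rw [show a + m + 1 - (m + 1) = a by omega]
    have h1 := rowProd_succ hκ hπ (m := m) (i := a) (by omega) (by omega)
    have h2 := LKB_off_diag hκ hπ (m := m) (i := a) (by omega) (by omega)
    have p1 := passUpSum_pos hκ hπ m (i := a) (j := a + m) (by omega)
    have p2 := passUpSum_pos hκ hπ m (i := a + 1) (j := a + m + 1) (by omega)
    refine mul_right_cancel₀ (add_pos p1 p2).ne' ?_
    linear_combination
      (rowProd n κ π 0 (a + m + 1) *
        ∏ k ∈ range (m + 1), extendByZero (LKB n κ π) (a + m + 1 - k) (a + m + 1)) * h2 +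
      passUpSum n κ π m a (a + m) * ih - κ * h1

/-- The product of row `i` of `π` and column `i` of its image under `LKB` is `κ`. -/
lemma row_mul_column_LKB (hκ : 0 < κ) (hπ : ∀ p, 0 < π p) {i : ℕ} (hi : 1 ≤ i) (hin : i ≤ n) :
    (∏ j ∈ Ico i (n + 1), extendByZero π i j) *
      ∏ k ∈ range i, extendByZero (LKB n κ π) (i - k) i = κ := by
  have h := rowProd_mul_column hκ hπ hin (i - 1) (by omega)
  rw [show i - 1 + 1 = i by omega, show i - (i - 1) = 1 by omega,
    rowProd_one (by omega), show 1 + (i - 1) = i by omega] at h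
  exact mul_right_cancel₀ (passUpSum_pos hκ hπ _ (by omega)).ne' h

lemma prod_mul_prod_LKB (hκ : 0 < κ) (hπ : ∀ p, 0 < π p) (e : ℕ → ℕ) :
    (∏ p : AnP n, π p ^ e p.lo) * ∏ p : AnP n, LKB n κ π p ^ e p.hi =
      ∏ i ∈ Icc 1 n, κ ^ e i := by
  have h1 := prod_AnP_rows (n := n) fun i j => extendByZero π i j ^ e i
  have h2 := prod_AnP_columns (n := n) fun i j => extendByZero (LKB n κ π) i j ^ e j
  simp only [extendByZero_val] at h1 h2
  rw [h1, h2, ← prod_mul_distrib]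
  refine prod_congr rfl fun i hi => ?_
  rw [mem_Icc] at hi
  rw [prod_pow, prod_pow, ← mul_pow, row_mul_column_LKB hκ hπ hi.1 hi.2]

lemma prod_mul_prod_LKB_reflect (hκ : 0 < κ) (hπ : ∀ p, 0 < π p) (e : ℕ → ℕ) :
    (∏ p : AnP n, π p ^ e (n + 1 - p.hi)) *
      ∏ p : AnP n, LKB n κ π p ^ e (n + 1 - p.lo) = ∏ i ∈ Icc 1 n, κ ^ e i := by
  have h := prod_mul_prod_LKB (π := fun p => π (AnP.reflect n p)) hκ (fun _ => hπ _) e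
  rw [← h]
  congr 1
  · refine (Fintype.prod_equiv (AnP.reflect n).toEquiv _ _ fun p => ?_).symm
    have := p.bounds
    change π (AnP.reflect n p) ^ _ = π (AnP.reflect n p) ^ e (n + 1 - (n + 1 - p.lo))
    congr 2
    omega
  · refine (Fintype.prod_equiv (AnP.reflect n).toEquiv _ _ fun p => ?_).symm
    have := p.bounds
    change aApplyB κ (rkAn n) _ (fun x => π (AnP.reflect n x)) p ^ _ =
      LKB n κ π (AnP.reflect n p) ^ e (n + 1 - (n + 1 - p.hi))
    rw [aApplyB_comp_orderIso _ rkAn_reflect]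
    congr 2
    omega

end LalanneKreweras

/-- For every `n ≥ 1`, `κ > 0` and `π : Aⁿ → ℝ>0`:
`∏_{[i,j]} π([i,j]) · ∏_{[i,j]} (LK^B π)([i,j]) = κ^n` and
`∏_{[i,j]} π([i,j])^(i+j) · ∏_{[i,j]} (LK^B π)([i,j])^(i+j) = κ^(n(n+1))`. -/
theorem stmt10 (n : ℕ) (hn : 1 ≤ n) (κ : ℝ) (hκ : 0 < κ)
    (π : AnP n → ℝ) (hpos : ∀ p, 0 < π p) :
    (∏ p : AnP n, π p) * (∏ p : AnP n, LKB n κ π p) = κ ^ n ∧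
    (∏ p : AnP n, π p ^ (p.val.1 + p.val.2)) *
      (∏ p : AnP n, (LKB n κ π p) ^ (p.val.1 + p.val.2)) = κ ^ (n * (n + 1)) := by
  have h0 := prod_mul_prod_LKB hκ hpos fun _ => 1
  simp only [pow_one, Finset.prod_const, Nat.card_Icc, Nat.add_sub_cancel] at h0
  refine ⟨h0, ?_⟩
  change (∏ p : AnP n, π p ^ (p.lo + p.hi)) * (∏ p : AnP n, LKB n κ π p ^ (p.lo + p.hi)) = _
  have h1 := prod_mul_prod_LKB hκ hpos fun i => i
  have h2 := prod_mul_prod_LKB_reflect hκ hpos fun i => i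
  have hK : 0 < ∏ i ∈ Finset.Icc 1 n, κ ^ i := Finset.prod_pos fun i _ => pow_pos hκ i
  refine mul_right_cancel₀ hK.ne' ?_
  rw [pow_mul, ← h0]
  nth_rw 1 [← h2]
  rw [← h1, mul_pow]
  simp only [← Finset.prod_pow, ← Finset.prod_mul_distrib, ← mul_pow]
  refine Finset.prod_congr rfl fun p _ => ?_
  have hp := p.bounds
  have e1 : n + 1 = p.hi + (n + 1 - p.hi) := by omega
  have e2 : n + 1 = p.lo + (n + 1 - p.lo) := by omega
  have t1 : π p ^ (n + 1) = π p ^ p.hi * π p ^ (n + 1 - p.hi) := by rw [← pow_add, ← e1]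
  have t2 : LKB n κ π p ^ (n + 1) =
      LKB n κ π p ^ p.lo * LKB n κ π p ^ (n + 1 - p.lo) := by rw [← pow_add, ← e2]
  rw [mul_pow (π p) _ (n + 1), t1, t2, mul_pow, pow_add, pow_add]
  ring
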